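/- Let p be the Simpson kernel on [0,1] (p(t) = t - 1/6 on [0,1/2], p(t) = t - 5/6 on (1/2,1]) and let g : [0,1] → ℝ be differentiable with integrable derivative. Then ∫₀¹ p(t)·g'(t) dt = (g(0) + 4g(1/2) + g(1))/6 − ∫₀¹ g(t) dt. -/

import Mathlib

open MeasureTheory intervalIntegral

theorem simpson_kernel_parts (g g' : ℝ → ℝ)
    (hg : ∀ t ∈ Set.Icc (0:ℝ) 1, HasDerivAt g (g' t) t)
    (hg' : IntervalIntegrable g' volume 0 1) :
    (∫ t in (0:ℝ)..1, (if t ≤ 1/2 then t - 1/6 else t - 5/6) * g' t)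
      = (g 0 + 4 * g (1/2) + g 1) / 6 - ∫ t in (0:ℝ)..1, g t := by
  have parts : ∀ a b c : ℝ, 0 ≤ a → a ≤ b → b ≤ 1 →
      (IntervalIntegrable g' volume a b ∧ IntervalIntegrable g volume a b ∧
      IntervalIntegrable (fun t => (t - c) * g' t) volume a b ∧
      (∫ t in a..b, (t - c) * g' t) = (b - c) * g b - (a - c) * g a - ∫ t in a..b, g t) := by
    intro a b c ha hab hb
    have hsub : Set.uIcc a b ⊆ Set.Icc (0:ℝ) 1 := by
      rw [Set.uIcc_of_le hab]
      exact Set.Icc_subset_Icc ha hb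
    have h1 : IntervalIntegrable g' volume a b := by
      apply hg'.mono_set
      rwa [Set.uIcc_of_le (zero_le_one' ℝ)]
    have hc : ContinuousOn g (Set.uIcc a b) :=
      fun x hx => (hg x (hsub hx)).continuousAt.continuousWithinAt
    refine ⟨h1, hc.intervalIntegrable, h1.continuousOn_mul (by fun_prop), ?_⟩
    have := integral_mul_deriv_eq_deriv_mul (a := a) (b := b) (u := fun t => t - c)
      (u' := fun _ => 1) (v := g) (v' := g')
      (fun x _ => (hasDerivAt_id x).sub_const c) (fun x hx => hg x (hsub hx))
      intervalIntegrable_const h1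
    simpa using this
  obtain ⟨-, a2, a3, a4⟩ := parts 0 (1/2) (1/6) (by norm_num) (by norm_num) (by norm_num)
  obtain ⟨-, b2, b3, b4⟩ := parts (1/2) 1 (5/6) (by norm_num) (by norm_num) (by norm_num)
  have e1 : Set.EqOn (fun t : ℝ => (t - 1/6) * g' t)
      (fun t => (if t ≤ 1/2 then t - 1/6 else t - 5/6) * g' t) (Set.uIoc 0 (1/2)) := by
    intro t ht
    rw [Set.uIoc_of_le (by norm_num)] at ht
    simp only [if_pos ht.2]
  have e2 : Set.EqOn (fun t : ℝ => (t - 5/6) * g' t)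
      (fun t => (if t ≤ 1/2 then t - 1/6 else t - 5/6) * g' t) (Set.uIoc (1/2) 1) := by
    intro t ht
    rw [Set.uIoc_of_le (by norm_num)] at ht
    simp only [if_neg (not_le.mpr ht.1)]
  rw [← integral_add_adjacent_intervals (a3.congr e1) (b3.congr e2),
    ← integral_add_adjacent_intervals a2 b2,
    ← integral_congr_ae (Filter.Eventually.of_forall e1),
    ← integral_congr_ae (Filter.Eventually.of_forall e2), a4, b4]
  ring
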